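/- arXiv:1605.04516 — 5 statements merged into one kernel-verified Lean document; each statement's English description precedes it below -/
import Mathlib

section
/- For any positive integers ℓ ≤ n, if S is (the underlying set of) a subgroup of S_ℓ, then Comp^n(S) = {τ ∈ S_n : Pat_ℓ(τ) ⊆ S} is (the underlying set of) a subgroup of S_n; that is, Comp^n(S) contains the identity permutation and is closed under composition and inverses. -/
open Equiv Finset Function

/-- `h_I : [ℓ] → [n]`: the increasing enumeration of an `ℓ`-element subset `I ⊆ [n]`,
i.e., the unique order isomorphism `([ℓ], ≤) → (I, ≤)` viewed as a map into `[n]`. -/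
def hmap {ℓ n : ℕ} (I : Finset (Fin n)) (hI : I.card = ℓ) : Fin ℓ → Fin n :=
  fun i => ((I.orderIsoOfFin hI) i : Fin n)

theorem hmap_injective {ℓ n : ℕ} (I : Finset (Fin n)) (hI : I.card = ℓ) :
    Function.Injective (hmap I hI) := fun a b h =>
  (I.orderIsoOfFin hI).injective (Subtype.ext h)

theorem mem_image_iff_perm {n : ℕ} (π : Equiv.Perm (Fin n)) (I : Finset (Fin n)) (a : Fin n) :
    a ∈ I ↔ π a ∈ I.image ⇑π := by
  constructor
  · exact fun h => Finset.mem_image_of_mem _ h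
  · intro h
    obtain ⟨b, hb, hba⟩ := Finset.mem_image.mp h
    rwa [← π.injective hba]

/-- The pattern `π_I := h_{π(I)}⁻¹ ∘ π ∘ h_I ∈ S_ℓ` of `π ∈ S_n` at an `ℓ`-element
subset `I ⊆ [n]`. -/
def patt {ℓ n : ℕ} (π : Equiv.Perm (Fin n)) (I : Finset (Fin n)) (hI : I.card = ℓ) :
    Equiv.Perm (Fin ℓ) :=
  (I.orderIsoOfFin hI).toEquiv.trans
    ((π.subtypeEquiv (mem_image_iff_perm π I)).trans
      ((I.image ⇑π).orderIsoOfFin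
        (by rw [Finset.card_image_of_injective _ π.injective, hI])).toEquiv.symm)

/-- `Pat_ℓ(π)`: the set of `ℓ`-patterns of `π ∈ S_n`. -/
def PattSet (ℓ : ℕ) {n : ℕ} (π : Equiv.Perm (Fin n)) : Set (Equiv.Perm (Fin ℓ)) :=
  {σ | ∃ (I : Finset (Fin n)) (hI : I.card = ℓ), σ = patt π I hI}

/-- `Comp^n(S)`: the set of `n`-permutations all of whose `ℓ`-patterns lie in `S`. -/
def CompSet (n : ℕ) {ℓ : ℕ} (S : Set (Equiv.Perm (Fin ℓ))) : Set (Equiv.Perm (Fin n)) :=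
  {τ | PattSet ℓ τ ⊆ S}

/-- Pattern involvement: `σ ≤ π` iff `σ = π_I` for some `ℓ`-element subset `I`. -/
def Involves {ℓ n : ℕ} (σ : Equiv.Perm (Fin ℓ)) (π : Equiv.Perm (Fin n)) : Prop :=
  σ ∈ PattSet ℓ π

/-- `gPat_ℓ(H)`: the subgroup of `S_ℓ` generated by the `ℓ`-patterns of members of `H`. -/
def gPat (ℓ : ℕ) {n : ℕ} (H : Set (Equiv.Perm (Fin n))) : Subgroup (Equiv.Perm (Fin ℓ)) :=
  Subgroup.closure (⋃ τ ∈ H, PattSet ℓ τ)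

/-- A function preserves a `k`-ary relation (componentwise application keeps tuples in
the relation). -/
def Preserves {α : Type*} {k : ℕ} (f : α → α) (ρ : Set (Fin k → α)) : Prop :=
  ∀ r ∈ ρ, (f ∘ r) ∈ ρ

/-- The `ℓ`-orbit `a^H = {σ ∘ a : σ ∈ H}`. -/
def orbitRel {ℓ n : ℕ} (H : Subgroup (Equiv.Perm (Fin n))) (a : Fin ℓ → Fin n) :
    Set (Fin ℓ → Fin n) :=
  {x | ∃ σ ∈ H, x = ⇑σ ∘ a}

/-- The reduction `red(u) = h_{range u}⁻¹ ∘ u` of a tuple with pairwise distinct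
entries. -/
def red {k n : ℕ} (u : Fin k → Fin n) (hu : Function.Injective u) : Fin k → Fin k :=
  fun i =>
    ((Finset.univ.image u).orderIsoOfFin
      (by rw [Finset.card_image_of_injective _ hu]; simp)).symm
      ⟨u i, Finset.mem_image_of_mem _ (Finset.mem_univ i)⟩

/-- `red(ρ) = {red(r) : r ∈ ρ}` for a set `ρ` of tuples with pairwise distinct entries. -/
def redSet {k n : ℕ} (ρ : Set (Fin k → Fin n)) : Set (Fin k → Fin k) :=
  {v | ∃ (r : Fin k → Fin n) (_ : r ∈ ρ) (hr : Function.Injective r), v = red r hr}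

/-- `ρ̌ := {h_I⁻¹ ∘ r : r ∈ ρ, range r ⊆ I, I an ℓ-element subset of [n]}`. -/
def checkRel (ℓ : ℕ) {k n : ℕ} (ρ : Set (Fin k → Fin n)) : Set (Fin k → Fin ℓ) :=
  {s | ∃ (r : Fin k → Fin n) (_ : r ∈ ρ) (I : Finset (Fin n)) (hI : I.card = ℓ)
        (hr : ∀ j, r j ∈ I), s = fun j => (I.orderIsoOfFin hI).symm ⟨r j, hr j⟩}

/-- `σ̂ := {h_J ∘ s : s ∈ σ, J an ℓ-element subset of [n]}`. -/
def hatRel (n : ℕ) {k ℓ : ℕ} (σ : Set (Fin k → Fin ℓ)) : Set (Fin k → Fin n) :=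
  {r | ∃ (s : Fin k → Fin ℓ) (_ : s ∈ σ) (J : Finset (Fin n)) (hJ : J.card = ℓ),
        r = hmap J hJ ∘ s}

/-- `ρ` is a pattern closed relation (pc-relation): for every `r ∈ ρ` and all
`ℓ`-element subsets `I, J ⊆ [n]` with `range r ⊆ I`, the tuple `h_J ∘ h_I⁻¹ ∘ r`
belongs to `ρ`. -/
def IsPC (ℓ : ℕ) {k n : ℕ} (ρ : Set (Fin k → Fin n)) : Prop :=
  ∀ r ∈ ρ, ∀ (I J : Finset (Fin n)) (hI : I.card = ℓ) (hJ : J.card = ℓ)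
    (hr : ∀ j, r j ∈ I),
    (fun j => hmap J hJ ((I.orderIsoOfFin hI).symm ⟨r j, hr j⟩)) ∈ ρ
/-- The defining square of a pattern: `h_{π(I)} ∘ π_I = π ∘ h_I`. -/
theorem hmap_patt {ℓ n : ℕ} (π : Equiv.Perm (Fin n)) (I : Finset (Fin n)) (hI : I.card = ℓ)
    (hJ : (I.image ⇑π).card = ℓ) (i : Fin ℓ) :
    hmap (I.image ⇑π) hJ (patt π I hI i) = π (hmap I hI i) := by
  simp [hmap, patt]

/-- A pattern is determined by its defining square. -/
theorem eq_patt_of_hmap {ℓ n : ℕ} (π : Equiv.Perm (Fin n)) (I J : Finset (Fin n))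
    (hI : I.card = ℓ) (hJ : J.card = ℓ) (hIJ : I.image ⇑π = J) (σ : Equiv.Perm (Fin ℓ))
    (h : ∀ i, hmap J hJ (σ i) = π (hmap I hI i)) : patt π I hI = σ := by
  subst hIJ
  ext1 i
  exact hmap_injective _ hJ ((hmap_patt π I hI hJ i).trans (h i).symm)

theorem card_image_perm {ℓ n : ℕ} (π : Equiv.Perm (Fin n)) {I : Finset (Fin n)}
    (hI : I.card = ℓ) : (I.image ⇑π).card = ℓ := by
  rw [Finset.card_image_of_injective _ π.injective, hI]

theorem patt_one {ℓ n : ℕ} (I : Finset (Fin n)) (hI : I.card = ℓ) :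
    patt (1 : Equiv.Perm (Fin n)) I hI = 1 :=
  eq_patt_of_hmap 1 I I hI hI (by simp) 1 fun _ => rfl

theorem patt_mul {ℓ n : ℕ} (a b : Equiv.Perm (Fin n)) (I : Finset (Fin n)) (hI : I.card = ℓ) :
    patt (a * b) I hI = patt a (I.image ⇑b) (card_image_perm b hI) * patt b I hI := by
  refine eq_patt_of_hmap _ I ((I.image ⇑b).image ⇑a) hI
    (card_image_perm a (card_image_perm b hI)) (by rw [Finset.image_image, Perm.coe_mul]) _
    fun i => ?_
  rw [Perm.mul_apply, hmap_patt, hmap_patt, Perm.mul_apply]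

theorem patt_inv {ℓ n : ℕ} (a : Equiv.Perm (Fin n)) (I : Finset (Fin n)) (hI : I.card = ℓ) :
    patt a⁻¹ I hI = (patt a (I.image ⇑a⁻¹) (card_image_perm a⁻¹ hI))⁻¹ := by
  have hmul : patt (a * a⁻¹) I hI = 1 := by simpa using patt_one I hI
  rw [patt_mul] at hmul
  exact (inv_eq_of_mul_eq_one_right hmul).symm

/-- Proposition 3.1: if `S ≤ S_ℓ` then `Comp^n(S)` is (the underlying set of) a
subgroup of `S_n`: it contains the identity and is closed under composition and
inverses. -/
theorem stmt5 (ℓ n : ℕ) (hℓ : 0 < ℓ) (hn : ℓ ≤ n) (S : Subgroup (Equiv.Perm (Fin ℓ))) :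
    (1 : Equiv.Perm (Fin n)) ∈ CompSet n (S : Set (Equiv.Perm (Fin ℓ))) ∧
    (∀ a ∈ CompSet n (S : Set (Equiv.Perm (Fin ℓ))),
      ∀ b ∈ CompSet n (S : Set (Equiv.Perm (Fin ℓ))),
        a * b ∈ CompSet n (S : Set (Equiv.Perm (Fin ℓ)))) ∧
    (∀ a ∈ CompSet n (S : Set (Equiv.Perm (Fin ℓ))),
        a⁻¹ ∈ CompSet n (S : Set (Equiv.Perm (Fin ℓ)))) := by
  refine ⟨?_, ?_, ?_⟩
  · rintro _ ⟨I, hI, rfl⟩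
    rw [patt_one]
    exact S.one_mem
  · rintro a ha b hb _ ⟨I, hI, rfl⟩
    rw [patt_mul]
    exact S.mul_mem (ha ⟨_, _, rfl⟩) (hb ⟨_, _, rfl⟩)
  · rintro a ha _ ⟨I, hI, rfl⟩
    rw [patt_inv]
    exact S.inv_mem (ha ⟨_, _, rfl⟩)
end

section
/- Let ℓ ≥ 4 and n = ℓ + 1. Then there exist a subgroup H ≤ S_n and a subset S ⊆ S_ℓ such that H = Comp^n(S), but there is no subgroup G ≤ S_ℓ such that H = Comp^n(G). -/
open Equiv Finset Function

theorem hmap_compl_singleton {ℓ : ℕ} (p : Fin (ℓ + 1))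
    (h : ({p}ᶜ : Finset (Fin (ℓ + 1))).card = ℓ) (i : Fin ℓ) :
    hmap {p}ᶜ h i = p.succAbove i := by
  simp [hmap]

theorem apply_hmap_eq_hmap_patt {ℓ n : ℕ} (π : Equiv.Perm (Fin n)) (I : Finset (Fin n))
    (hI : I.card = ℓ) (hI' : (I.image ⇑π).card = ℓ) (i : Fin ℓ) :
    π (hmap I hI i) = hmap (I.image ⇑π) hI' (patt π I hI i) := by
  simp [hmap, patt, -Finset.coe_orderIsoOfFin_apply]

theorem apply_succAbove_eq_patt {ℓ : ℕ} (π : Equiv.Perm (Fin (ℓ + 1))) (p : Fin (ℓ + 1))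
    (h : ({p}ᶜ : Finset (Fin (ℓ + 1))).card = ℓ) (i : Fin ℓ) :
    π (p.succAbove i) = (π p).succAbove (patt π {p}ᶜ h i) := by
  have himage : ({p}ᶜ : Finset (Fin (ℓ + 1))).image ⇑π = {π p}ᶜ := by
    rw [← Finset.coe_inj]
    push_cast
    rw [Set.image_compl_eq π.bijective, Set.image_singleton]
  have hcard : (({p}ᶜ : Finset (Fin (ℓ + 1))).image ⇑π).card = ℓ := by
    rw [Finset.card_image_of_injective _ π.injective, h]
  rw [← hmap_compl_singleton p h, apply_hmap_eq_hmap_patt π _ h hcard]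
  simp only [himage, hmap_compl_singleton]

/-- Patterns of length `ℓ` of a permutation of length `ℓ + 1` arise by deleting one position. -/
theorem mem_PattSet_succ_iff {ℓ : ℕ} {π : Equiv.Perm (Fin (ℓ + 1))} {σ : Equiv.Perm (Fin ℓ)} :
    σ ∈ PattSet ℓ π ↔ ∃ p, ∀ i, π (p.succAbove i) = (π p).succAbove (σ i) := by
  constructor
  · rintro ⟨I, hI, rfl⟩
    have hc : Iᶜ.card = 1 := by simp [Finset.card_compl, hI]
    obtain ⟨p, hp⟩ := Finset.card_eq_one.mp hc
    obtain rfl : I = {p}ᶜ := by rw [← hp, compl_compl]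
    exact ⟨p, apply_succAbove_eq_patt π p hI⟩
  · rintro ⟨p, hp⟩
    have h : ({p}ᶜ : Finset (Fin (ℓ + 1))).card = ℓ := by simp [Finset.card_compl]
    refine ⟨{p}ᶜ, h, Equiv.ext fun i => Fin.succAbove_right_injective (p := π p) ?_⟩
    rw [← hp, apply_succAbove_eq_patt π p h]

theorem exists_mem_PattSet_succ {ℓ : ℕ} (π : Equiv.Perm (Fin (ℓ + 1))) (p : Fin (ℓ + 1)) :
    ∃ σ ∈ PattSet ℓ π, ∀ i, π (p.succAbove i) = (π p).succAbove (σ i) := by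
  have h : ({p}ᶜ : Finset (Fin (ℓ + 1))).card = ℓ := by simp [Finset.card_compl]
  exact ⟨patt π {p}ᶜ h, ⟨_, h, rfl⟩, apply_succAbove_eq_patt π p h⟩

theorem Fin.val_succAbove_eq_ite {n : ℕ} (p : Fin (n + 1)) (i : Fin n) :
    (p.succAbove i : ℕ) = if (i : ℕ) < p then (i : ℕ) else i + 1 := by
  simp only [Fin.succAbove, Fin.lt_def, Fin.val_castSucc]
  split_ifs <;> simp

/-- The relation between a permutation and the pattern obtained by deleting position `p`,
in terms of natural numbers. -/
theorem val_apply_of_pattern {ℓ : ℕ} {π : Equiv.Perm (Fin (ℓ + 1))} {σ : Equiv.Perm (Fin ℓ)}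
    {p : Fin (ℓ + 1)} (h : ∀ i, π (p.succAbove i) = (π p).succAbove (σ i))
    (a : Fin (ℓ + 1)) (i : Fin ℓ) (hai : (a : ℕ) = if (i : ℕ) < p then (i : ℕ) else i + 1) :
    (π a : ℕ) = if (σ i : ℕ) < π p then (σ i : ℕ) else σ i + 1 := by
  have ha : a = p.succAbove i := Fin.ext (by rw [hai, Fin.val_succAbove_eq_ite])
  rw [ha, h, Fin.val_succAbove_eq_ite]

theorem val_swap_apply {n : ℕ} (a b i : Fin n) :
    (swap a b i : ℕ) = if (i : ℕ) = a then (b : ℕ) else if (i : ℕ) = b then (a : ℕ) else i := by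
  simp only [swap_apply_def, Fin.ext_iff]
  split_ifs <;> rfl

/-- The permutations that exchange the two extreme points, together with those that fix the last
point and, apart from the identity, move the last but one. -/
def endSwapOrFixLast (k : ℕ) : Set (Equiv.Perm (Fin (k + 4))) :=
  {σ | σ = swap 0 (Fin.last (k + 3)) ∨
    σ (Fin.last (k + 3)) = Fin.last (k + 3) ∧
      (σ (Fin.last (k + 2)).castSucc = (Fin.last (k + 2)).castSucc → σ = 1)}

theorem one_mem_CompSet_endSwapOrFixLast (k : ℕ) :
    1 ∈ CompSet (k + 4 + 1) (endSwapOrFixLast k) := by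
  intro σ hσ
  obtain ⟨p, hp⟩ := mem_PattSet_succ_iff.mp hσ
  obtain rfl : σ = 1 := Equiv.ext fun i => (Fin.succAbove_right_injective (hp i)).symm
  exact Or.inr ⟨rfl, fun _ => rfl⟩

theorem swap_mem_CompSet_endSwapOrFixLast (k : ℕ) :
    swap 0 (Fin.last (k + 3)).castSucc ∈ CompSet (k + 4 + 1) (endSwapOrFixLast k) := by
  intro σ hσ
  obtain ⟨p, hp⟩ := mem_PattSet_succ_iff.mp hσ
  have key := val_apply_of_pattern hp
  simp only [val_swap_apply, Fin.val_zero, Fin.val_castSucc, Fin.val_last] at key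
  by_cases hpl : (p : ℕ) = k + 4
  · left
    ext i
    have := key i.castSucc i (by rw [Fin.val_castSucc, if_pos (by omega)])
    rw [val_swap_apply]
    simp only [Fin.val_zero, Fin.val_castSucc, Fin.val_last] at this ⊢
    grind
  · right
    have hlast := key (Fin.last (k + 4)) (Fin.last (k + 3)) (by simp; omega)
    constructor
    · ext
      simp only [Fin.val_last] at hlast ⊢
      grind
    · intro hfix
      exfalso
      by_cases hp3 : (p : ℕ) = k + 3
      · have := key ⟨k + 2, by omega⟩ (Fin.last (k + 2)).castSucc (by simp; omega)
        rw [hfix] at this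
        simp only [Fin.val_castSucc, Fin.val_last] at this
        grind
      · have := key ⟨k + 3, by omega⟩ (Fin.last (k + 2)).castSucc (by simp; omega)
        rw [hfix] at this
        simp only [Fin.val_castSucc, Fin.val_last] at this
        grind

/-- A permutation all of whose patterns are in `endSwapOrFixLast` fixes the last point. -/
theorem apply_last_of_mem_CompSet {k : ℕ} {π : Equiv.Perm (Fin (k + 4 + 1))}
    (hπ : π ∈ CompSet (k + 4 + 1) (endSwapOrFixLast k)) :
    π (Fin.last (k + 4)) = Fin.last (k + 4) := by
  by_contra hne
  have hne' : (π (Fin.last (k + 4)) : ℕ) ≠ k + 4 := fun h => hne (Fin.ext h)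
  have hlt := (π (Fin.last (k + 4))).isLt
  have hinj : ∀ a b : Fin (k + 4 + 1), (π a : ℕ) = π b → (a : ℕ) = b := fun a b h =>
    congrArg Fin.val (π.injective (Fin.ext h))
  -- Deleting a position `p` other than the last one leaves the last entry in last position.
  have key : ∀ p : Fin (k + 4 + 1), (p : ℕ) < k + 4 →
      ((∀ i, π (p.succAbove i) = (π p).succAbove (swap 0 (Fin.last (k + 3)) i)) ∧
        (π (Fin.last (k + 4)) : ℕ) = if 0 < (π p : ℕ) then 0 else 1) ∨
      ((π p : ℕ) = k + 4 ∧ (π (Fin.last (k + 4)) : ℕ) = k + 3) := by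
    intro p hp
    obtain ⟨σ, hσ, h⟩ := exists_mem_PattSet_succ π p
    have hl := val_apply_of_pattern h (Fin.last (k + 4)) (Fin.last (k + 3)) (by simp; omega)
    rcases hπ hσ with rfl | ⟨hfix, -⟩
    · left
      refine ⟨h, ?_⟩
      simpa using hl
    · right
      rw [hfix, Fin.val_last] at hl
      have := (π p).isLt
      grind
  have k0 := key 0 (by simp)
  have k1 := key 1 (by simp)
  have k2 := key ⟨2, by omega⟩ (by simp)
  have k3 := key ⟨3, by omega⟩ (by simp)
  have i01 := hinj 0 1
  have i02 := hinj 0 ⟨2, by omega⟩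
  have i12 := hinj 1 ⟨2, by omega⟩
  have i03 := hinj 0 ⟨3, by omega⟩
  have i13 := hinj 1 ⟨3, by omega⟩
  have i23 := hinj ⟨2, by omega⟩ ⟨3, by omega⟩
  simp only [Fin.val_zero, Fin.val_one] at i01 i02 i12 i03 i13 i23
  have hm : (π (Fin.last (k + 4)) : ℕ) = 0 := by grind
  have s0 : ∀ i, _ := (k0.resolve_right (by omega)).1
  have s3 : ∀ i, _ := (k3.resolve_right (by omega)).1
  have a1 := val_apply_of_pattern s0 1 0 (by simp)
  have a2 := val_apply_of_pattern s0 ⟨2, by omega⟩ 1 (by simp)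
  have b1 := val_apply_of_pattern s3 1 1 (by simp)
  have b2 := val_apply_of_pattern s3 ⟨2, by omega⟩ ⟨2, by omega⟩ (by simp)
  simp only [val_swap_apply, Fin.val_zero, Fin.val_one, Fin.val_last] at a1 a2 b1 b2
  grind

theorem eq_one_or_eq_swap_of_mem_CompSet {k : ℕ} {π : Equiv.Perm (Fin (k + 4 + 1))}
    (hπ : π ∈ CompSet (k + 4 + 1) (endSwapOrFixLast k)) :
    π = 1 ∨ π = swap 0 (Fin.last (k + 3)).castSucc := by
  have hlast := apply_last_of_mem_CompSet hπ
  obtain ⟨σ, hσ, h⟩ := exists_mem_PattSet_succ π (Fin.last (k + 4))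
  rw [hlast] at h
  simp only [Fin.succAbove_last] at h
  rcases hπ hσ with rfl | ⟨hfix, -⟩
  · right
    ext a
    induction a using Fin.lastCases with
    | last =>
      rw [hlast, val_swap_apply]
      simp
    | cast i =>
      rw [h, Fin.val_castSucc, val_swap_apply, val_swap_apply]
      simp
  · left
    have hpen := h (Fin.last (k + 3))
    rw [hfix] at hpen
    have hlast' : (π (Fin.last (k + 4)) : ℕ) = k + 4 := by rw [hlast, Fin.val_last]
    have hpen' : (π (Fin.last (k + 3)).castSucc : ℕ) = k + 3 := by rw [hpen]; simp
    have hinj : ∀ a b : Fin (k + 4 + 1), (π a : ℕ) = π b → (a : ℕ) = b := fun a b h =>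
      congrArg Fin.val (π.injective (Fin.ext h))
    -- Deleting any position before the last two yields the identity.
    have key : ∀ p : Fin (k + 4 + 1), (p : ℕ) < k + 3 →
        ∀ i, π (p.succAbove i) = (π p).succAbove ((1 : Equiv.Perm (Fin (k + 4))) i) := by
      intro p hp
      obtain ⟨τ, hτ, h⟩ := exists_mem_PattSet_succ π p
      have h1 := val_apply_of_pattern h (Fin.last (k + 4)) (Fin.last (k + 3)) (by simp; omega)
      have h2 := val_apply_of_pattern h (Fin.last (k + 3)).castSucc (Fin.last (k + 2)).castSucc
        (by simp; omega)
      have n1 := hinj p (Fin.last (k + 4))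
      have n2 := hinj p (Fin.last (k + 3)).castSucc
      simp only [Fin.val_last, Fin.val_castSucc] at n1 n2
      have hlt := (π p).isLt
      rcases hπ hτ with rfl | ⟨-, hone⟩
      · simp only [val_swap_apply, Fin.val_zero, Fin.val_last] at h1
        grind
      · rw [hone (Fin.ext (by simp only [Fin.val_last, Fin.val_castSucc]; grind))] at h
        exact h
    have a0 := val_apply_of_pattern (key ⟨2, by omega⟩ (by simp)) 0 0 (by simp)
    have a1 := val_apply_of_pattern (key ⟨2, by omega⟩ (by simp)) 1 1 (by simp)
    have b0 := val_apply_of_pattern (key 1 (by simp)) 0 0 (by simp)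
    simp only [Equiv.Perm.coe_one, id_eq, Fin.val_zero, Fin.val_one] at a0 a1 b0
    have hzero : π 0 = 0 := Fin.ext (by rw [Fin.val_zero]; grind)
    ext a
    induction a using Fin.cases with
    | zero => rw [hzero]; rfl
    | succ i =>
      have := key 0 (by simp) i
      rw [hzero] at this
      simpa using congrArg Fin.val this

/-- The patterns of `swap 0 1` are itself and the identity. -/
theorem swap_zero_one_mem_CompSet {k : ℕ} {G : Subgroup (Equiv.Perm (Fin (k + 4)))}
    (hG : swap 0 1 ∈ G) :
    swap 0 1 ∈ CompSet (k + 4 + 1) (G : Set (Equiv.Perm (Fin (k + 4)))) := by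
  intro σ hσ
  obtain ⟨p, hp⟩ := mem_PattSet_succ_iff.mp hσ
  have key : ∀ i : Fin (k + 4), _ := fun i =>
    val_apply_of_pattern hp (p.succAbove i) i (Fin.val_succAbove_eq_ite p i)
  simp only [val_swap_apply, Fin.val_zero, Fin.val_one, Fin.val_succAbove_eq_ite] at key
  by_cases hp2 : (p : ℕ) < 2
  · have : σ = 1 := by
      ext i
      have := key i
      rw [Equiv.Perm.one_apply]
      grind
    rw [this]
    exact G.one_mem
  · have : σ = swap 0 1 := by
      ext i
      have := key i
      rw [val_swap_apply, Fin.val_zero, Fin.val_one]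
      grind
    rwa [this]

theorem swap_zero_one_mem_of_swap_mem_CompSet {k : ℕ} {G : Subgroup (Equiv.Perm (Fin (k + 4)))}
    (hG : swap 0 (Fin.last (k + 3)).castSucc ∈
      CompSet (k + 4 + 1) (G : Set (Equiv.Perm (Fin (k + 4))))) :
    swap 0 1 ∈ G := by
  obtain ⟨c, hc, hc'⟩ :=
    exists_mem_PattSet_succ (swap 0 (Fin.last (k + 3)).castSucc : Equiv.Perm (Fin (k + 4 + 1))) 0
  obtain ⟨u, hu, hu'⟩ :=
    exists_mem_PattSet_succ (swap 0 (Fin.last (k + 3)).castSucc : Equiv.Perm (Fin (k + 4 + 1))) 1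
  have hc0 := val_apply_of_pattern hc' 1 0 (by simp)
  have hc1 := val_apply_of_pattern hc' (Fin.last (k + 3)).castSucc (Fin.last (k + 2)).castSucc
    (by simp)
  simp only [val_swap_apply, Fin.val_zero, Fin.val_one, Fin.val_castSucc, Fin.val_last]
    at hc0 hc1
  have hc0 : c 0 = 1 := Fin.ext (by rw [Fin.val_one]; grind)
  have hc1 : c (Fin.last (k + 2)).castSucc = 0 := Fin.ext (by rw [Fin.val_zero]; grind)
  have hu_eq : u = swap 0 (Fin.last (k + 2)).castSucc := by
    ext i
    have := val_apply_of_pattern hu' _ i (Fin.val_succAbove_eq_ite 1 i)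
    simp only [val_swap_apply, Fin.val_zero, Fin.val_one, Fin.val_castSucc, Fin.val_last,
      Fin.val_succAbove_eq_ite] at this ⊢
    grind
  have hconj : swap (0 : Fin (k + 4)) 1 = c * u * c⁻¹ := by
    rw [hu_eq, ← swap_apply_apply, hc0, hc1, swap_comm]
  rw [hconj]
  exact G.mul_mem (G.mul_mem (hG hc) (hG hu)) (G.inv_mem (hG hc))

/-- The two-element subgroup generated by a transposition. -/
def swapSubgroup {α : Type*} [DecidableEq α] (a b : α) : Subgroup (Equiv.Perm α) where
  carrier := {1, swap a b}
  one_mem' := Or.inl rfl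
  mul_mem' := by
    rintro x y (rfl | rfl) (rfl | rfl) <;> simp
  inv_mem' := by
    rintro x (rfl | rfl) <;> simp

/-- Lemma 3.6: for `ℓ ≥ 4` and `n = ℓ + 1`, there is a subgroup `H ≤ S_n` with
`H = Comp^n(S)` for some subset `S ⊆ S_ℓ`, but `H ≠ Comp^n(G)` for every subgroup
`G ≤ S_ℓ`. -/
theorem stmt9 (ℓ : ℕ) (hℓ : 4 ≤ ℓ) :
    ∃ (H : Subgroup (Equiv.Perm (Fin (ℓ + 1)))) (S : Set (Equiv.Perm (Fin ℓ))),
      (H : Set (Equiv.Perm (Fin (ℓ + 1)))) = CompSet (ℓ + 1) S ∧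
      ∀ G : Subgroup (Equiv.Perm (Fin ℓ)),
        (H : Set (Equiv.Perm (Fin (ℓ + 1)))) ≠
          CompSet (ℓ + 1) (G : Set (Equiv.Perm (Fin ℓ))) := by
  obtain ⟨k, rfl⟩ : ∃ k, ℓ = k + 4 := ⟨ℓ - 4, by omega⟩
  have hH : (swapSubgroup 0 (Fin.last (k + 3)).castSucc : Set (Equiv.Perm (Fin (k + 4 + 1)))) =
      CompSet (k + 4 + 1) (endSwapOrFixLast k) := by
    ext π
    constructor
    · rintro (rfl | rfl)
      · exact one_mem_CompSet_endSwapOrFixLast k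
      · exact swap_mem_CompSet_endSwapOrFixLast k
    · exact eq_one_or_eq_swap_of_mem_CompSet
  refine ⟨_, _, hH, fun G hG => ?_⟩
  have hswap : swap 0 (Fin.last (k + 3)).castSucc ∈
      CompSet (k + 4 + 1) (G : Set (Equiv.Perm (Fin (k + 4)))) := by
    rw [← hG]
    exact Or.inr rfl
  have hmem := swap_zero_one_mem_CompSet (swap_zero_one_mem_of_swap_mem_CompSet hswap)
  rw [← hG] at hmem
  rcases hmem with h | h
  · simpa using congrArg Fin.val (DFunLike.congr_fun h 0)
  · simpa using congrArg Fin.val (DFunLike.congr_fun h 0)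
end

section
/- Let ℓ ≤ n be positive integers and let H be a subgroup of S_n such that H = Comp^n(S) for some subset S ⊆ S_ℓ. Then H equals the set of all permutations of [n] preserving each of the ℓ-orbit relations (h_I)^H, where I ranges over all ℓ-element subsets of [n]; that is, H = Aut{(h_I)^H : I an ℓ-element subset of [n]}. In particular, H is ℓ-closed: H = Aut Inv^{(ℓ)} H, where Inv^{(ℓ)} H is the set of all ℓ-ary relations on [n] preserved by every member of H. -/
open Equiv Finset Function

/-- The pattern of `π` at `I` depends only on the tuple `π ∘ h_I`. -/
theorem patt_congr {ℓ n : ℕ} {π σ : Equiv.Perm (Fin n)} {I : Finset (Fin n)} (hI : I.card = ℓ)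
    (h : ⇑π ∘ hmap I hI = ⇑σ ∘ hmap I hI) : patt π I hI = patt σ I hI := by
  have key : ∀ (J K : Finset (Fin n)) (hJ : J.card = ℓ) (hK : K.card = ℓ) (_ : J = K)
      (x y : Fin n) (hx : x ∈ J) (hy : y ∈ K) (_ : x = y),
      (J.orderIsoOfFin hJ).symm ⟨x, hx⟩ = (K.orderIsoOfFin hK).symm ⟨y, hy⟩ := by
    rintro J _ _ _ rfl x _ _ _ rfl
    rfl
  have hmem : ∀ a ∈ I, π a = σ a := by
    intro a ha
    have := congrFun h ((I.orderIsoOfFin hI).symm ⟨a, ha⟩)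
    simpa [hmap] using this
  ext i : 1
  have hcard : ∀ τ : Equiv.Perm (Fin n), (I.image ⇑τ).card = ℓ := fun τ => by
    rw [Finset.card_image_of_injective _ τ.injective, hI]
  exact key _ _ (hcard π) (hcard σ) (Finset.image_congr hmem) _ _ _ _ (congrFun h i)

/-- Proposition 4.1: if `H ≤ S_n` is of the form `Comp^n(S)` for some `S ⊆ S_ℓ`, then
`H = Aut {(h_I)^H : I ∈ ([n] choose ℓ)}`; in particular `H` is `ℓ`-closed:
`H = Aut Inv^{(ℓ)} H`. -/
theorem stmt10 (ℓ n : ℕ) (hℓ : 0 < ℓ) (hn : ℓ ≤ n) (H : Subgroup (Equiv.Perm (Fin n)))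
    (hH : ∃ S : Set (Equiv.Perm (Fin ℓ)), (H : Set (Equiv.Perm (Fin n))) = CompSet n S) :
    (H : Set (Equiv.Perm (Fin n))) =
      {π : Equiv.Perm (Fin n) | ∀ (I : Finset (Fin n)) (hI : I.card = ℓ),
        Preserves ⇑π (orbitRel H (hmap I hI))} ∧
    (H : Set (Equiv.Perm (Fin n))) =
      {π : Equiv.Perm (Fin n) | ∀ ρ : Set (Fin ℓ → Fin n),
        (∀ τ ∈ H, Preserves ⇑τ ρ) → Preserves ⇑π ρ} := by
  have mem_of_orbits : ∀ π : Equiv.Perm (Fin n), (∀ (I : Finset (Fin n)) (hI : I.card = ℓ),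
      Preserves ⇑π (orbitRel H (hmap I hI))) → π ∈ H := by
    obtain ⟨S, hS⟩ := hH
    intro π hπ
    rw [← SetLike.mem_coe, hS]
    rintro _ ⟨I, hI, rfl⟩
    obtain ⟨σ, hσ, h⟩ := hπ I hI (hmap I hI) ⟨1, H.one_mem, rfl⟩
    rw [patt_congr hI h]
    rw [← SetLike.mem_coe, hS] at hσ
    exact hσ ⟨I, hI, rfl⟩
  have preserves_orbit : ∀ τ ∈ H, ∀ a : Fin ℓ → Fin n, Preserves ⇑τ (orbitRel H a) := by
    rintro τ hτ a _ ⟨σ, hσ, rfl⟩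
    exact ⟨τ * σ, H.mul_mem hτ hσ, rfl⟩
  constructor
  · ext π
    exact ⟨fun h I hI => preserves_orbit π h _, mem_of_orbits π⟩
  · ext π
    exact ⟨fun h ρ hρ => hρ π h, fun h =>
      mem_of_orbits π fun I hI => h _ fun τ hτ => preserves_orbit τ hτ _⟩
end

section
/- Let ℓ ≤ n be positive integers and let H ≤ S_n be a subgroup. Then gComp^n(gPat_ℓ(H)) = Aut(pcInv H); that is, the Galois closure of H under the monotone Galois connection (gPat_ℓ, gComp^n) equals the group of all permutations of [n] preserving every pattern closed invariant relation of H. -/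
open Equiv Finset Function

theorem hmap_mem {ℓ n : ℕ} (I : Finset (Fin n)) (hI : I.card = ℓ) (i : Fin ℓ) :
    hmap I hI i ∈ I :=
  ((I.orderIsoOfFin hI) i).2

theorem image_hmap_comp {ℓ n : ℕ} (I : Finset (Fin n)) (hI : I.card = ℓ)
    (g : Equiv.Perm (Fin ℓ)) : Finset.univ.image (hmap I hI ∘ g) = I := by
  apply Finset.eq_of_subset_of_card_le
  · intro a ha
    obtain ⟨i, -, rfl⟩ := Finset.mem_image.mp ha
    exact hmap_mem I hI _
  · rw [Finset.card_image_of_injective _ ((hmap_injective I hI).comp g.injective)]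
    simp [hI]

theorem hmap_comp_patt {ℓ n : ℕ} (π : Equiv.Perm (Fin n)) (I : Finset (Fin n))
    (hI : I.card = ℓ) :
    hmap (I.image ⇑π) (card_image_perm π hI) ∘ patt π I hI = π ∘ hmap I hI := by
  funext i
  simp [hmap, patt]

theorem hmap_comp_perm_inj {ℓ n : ℕ} {I J : Finset (Fin n)} {hI : I.card = ℓ}
    {hJ : J.card = ℓ} {g g' : Equiv.Perm (Fin ℓ)}
    (h : hmap I hI ∘ g = hmap J hJ ∘ g') : g = g' := by
  have hIJ : I = J := by rw [← image_hmap_comp I hI g, h, image_hmap_comp]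
  subst hIJ
  exact Equiv.ext fun i => hmap_injective I hI (congrFun h i)

theorem hmap_symm_hmap {ℓ k n : ℕ} (I : Finset (Fin n)) (hI : I.card = ℓ)
    (s : Fin k → Fin ℓ) (hr : ∀ j, (hmap I hI ∘ s) j ∈ I) :
    (fun j => (I.orderIsoOfFin hI).symm ⟨(hmap I hI ∘ s) j, hr j⟩) = s := by
  funext j
  exact (I.orderIsoOfFin hI).symm_apply_apply (s j)

theorem IsPC.hmap_comp_mem {ℓ k n : ℕ} {ρ : Set (Fin k → Fin n)} (hρ : IsPC ℓ ρ)
    {I J : Finset (Fin n)} {hI : I.card = ℓ} (hJ : J.card = ℓ) {s : Fin k → Fin ℓ}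
    (h : hmap I hI ∘ s ∈ ρ) : hmap J hJ ∘ s ∈ ρ := by
  have hr : ∀ j, (hmap I hI ∘ s) j ∈ I := fun j => hmap_mem I hI _
  have := hρ _ h I J hI hJ hr
  rwa [← hmap_symm_hmap I hI s hr]

/-- Members of `gPat ℓ H` act on the tuples over `[ℓ]` underlying an `H`-invariant
pc-relation. -/
theorem IsPC.hmap_comp_gPat_mem {ℓ k n : ℕ} {H : Subgroup (Equiv.Perm (Fin n))}
    {ρ : Set (Fin k → Fin n)} (hρ : IsPC ℓ ρ) (hH : ∀ τ ∈ H, Preserves ⇑τ ρ)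
    {g : Equiv.Perm (Fin ℓ)} (hg : g ∈ gPat ℓ (H : Set (Equiv.Perm (Fin n))))
    {I : Finset (Fin n)} (hI : I.card = ℓ) (s : Fin k → Fin ℓ) :
    hmap I hI ∘ s ∈ ρ ↔ hmap I hI ∘ g ∘ s ∈ ρ := by
  induction hg using Subgroup.closure_induction generalizing s with
  | mem g hg =>
    obtain ⟨τ, hτ, J, hJ, rfl⟩ := Set.mem_iUnion₂.mp hg
    have key : hmap (J.image ⇑τ) (card_image_perm τ hJ) ∘ patt τ J hJ ∘ s =
        τ ∘ hmap J hJ ∘ s := by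
      rw [← Function.comp_assoc, hmap_comp_patt, Function.comp_assoc]
    constructor
    · intro h
      apply hρ.hmap_comp_mem (I := J.image ⇑τ) (hI := card_image_perm τ hJ) hI
      rw [key]
      exact hH τ hτ _ (hρ.hmap_comp_mem hJ h)
    · intro h
      have h' := hρ.hmap_comp_mem (card_image_perm τ hJ) h
      rw [key] at h'
      have h'' := hH τ⁻¹ (H.inv_mem hτ) _ h'
      rw [← Function.comp_assoc, ← Equiv.Perm.coe_mul, inv_mul_cancel, Equiv.Perm.coe_one,
        Function.id_comp] at h''
      exact hρ.hmap_comp_mem hI h''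
  | one => simp
  | mul a b _ _ ha hb => rw [hb s, ha (b ∘ s), Equiv.Perm.coe_mul, Function.comp_assoc]
  | inv a _ ha =>
    rw [ha (⇑a⁻¹ ∘ s), ← Function.comp_assoc ⇑a, ← Equiv.Perm.coe_mul, mul_inv_cancel,
      Equiv.Perm.coe_one, Function.id_comp]

theorem exists_eq_hmap_comp {ℓ k n : ℕ} (hk : k ≤ ℓ) (hn : ℓ ≤ n) (r : Fin k → Fin n) :
    ∃ (I : Finset (Fin n)) (hI : I.card = ℓ) (s : Fin k → Fin ℓ), r = hmap I hI ∘ s := by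
  have hcard : (Finset.univ.image r).card ≤ ℓ :=
    Finset.card_image_le.trans (by simpa using hk)
  obtain ⟨I, hrI, -, hI⟩ := Finset.exists_subsuperset_card_eq
    (Finset.subset_univ (Finset.univ.image r)) hcard (by simpa using hn)
  refine ⟨I, hI, fun j => (I.orderIsoOfFin hI).symm
    ⟨r j, hrI (Finset.mem_image_of_mem r (Finset.mem_univ j))⟩, ?_⟩
  funext j
  simp [hmap]

/-- The `ℓ`-ary relation on `[n]` of all tuples that enumerate an `ℓ`-element subset
according to a member of `G`. -/
def hatGroup (n : ℕ) {ℓ : ℕ} (G : Subgroup (Equiv.Perm (Fin ℓ))) : Set (Fin ℓ → Fin n) :=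
  {r | ∃ (J : Finset (Fin n)) (hJ : J.card = ℓ), ∃ g ∈ G, r = hmap J hJ ∘ ⇑g}

theorem isPC_hatGroup (n : ℕ) {ℓ : ℕ} (G : Subgroup (Equiv.Perm (Fin ℓ))) :
    IsPC ℓ (hatGroup n G) := by
  rintro _ ⟨I', hI', g, hg, rfl⟩ I J hI hJ hr
  have hsub : I' ⊆ I := by
    rw [← image_hmap_comp I' hI' g]
    intro a ha
    obtain ⟨i, -, rfl⟩ := Finset.mem_image.mp ha
    exact hr i
  obtain rfl : I' = I := Finset.eq_of_subset_of_card_le hsub (by rw [hI, hI'])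
  refine ⟨J, hJ, g, hg, ?_⟩
  conv_rhs => rw [← hmap_symm_hmap I' hI' g hr]
  rfl

theorem preserves_hatGroup {ℓ n : ℕ} {H : Subgroup (Equiv.Perm (Fin n))}
    {τ : Equiv.Perm (Fin n)} (hτ : τ ∈ H) :
    Preserves ⇑τ (hatGroup n (gPat ℓ (H : Set (Equiv.Perm (Fin n))))) := by
  rintro _ ⟨J, hJ, g, hg, rfl⟩
  refine ⟨J.image ⇑τ, card_image_perm τ hJ, patt τ J hJ * g, mul_mem ?_ hg, ?_⟩
  · exact Subgroup.subset_closure (Set.mem_iUnion₂.mpr ⟨τ, hτ, J, hJ, rfl⟩)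
  · rw [Equiv.Perm.coe_mul, ← Function.comp_assoc, ← Function.comp_assoc, hmap_comp_patt]

/-- Theorem 5.3(A): `gComp^n(gPat_ℓ(H)) = Aut (pcInv H)`, i.e., the Galois closure of
`H ≤ S_n` equals the set of all permutations preserving every pattern closed invariant
relation (of arity `k ≤ ℓ`) of `H`. -/
theorem stmt14 (ℓ n : ℕ) (hℓ : 0 < ℓ) (hn : ℓ ≤ n) (H : Subgroup (Equiv.Perm (Fin n))) :
    CompSet n ((gPat ℓ (H : Set (Equiv.Perm (Fin n)))) : Set (Equiv.Perm (Fin ℓ))) =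
      {π : Equiv.Perm (Fin n) | ∀ (k : ℕ), 0 < k → k ≤ ℓ →
        ∀ ρ : Set (Fin k → Fin n), IsPC ℓ ρ →
          (∀ τ ∈ H, Preserves ⇑τ ρ) → Preserves ⇑π ρ} := by
  apply Set.Subset.antisymm
  · intro π hπ k _ hk ρ hρ hH r hr
    obtain ⟨I, hI, s, rfl⟩ := exists_eq_hmap_comp hk hn r
    rw [← Function.comp_assoc, ← hmap_comp_patt, Function.comp_assoc]
    have hmem : patt π I hI ∈ gPat ℓ (H : Set (Equiv.Perm (Fin n))) := hπ ⟨I, hI, rfl⟩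
    exact (hρ.hmap_comp_gPat_mem hH hmem _ s).mp (hρ.hmap_comp_mem _ hr)
  · rintro π hπ _ ⟨I, hI, rfl⟩
    obtain ⟨J, hJ, g, hg, h⟩ := hπ ℓ hℓ le_rfl _ (isPC_hatGroup n _)
      (fun τ hτ => preserves_hatGroup hτ) (hmap I hI)
      ⟨I, hI, 1, one_mem _, by rw [Equiv.Perm.coe_one, Function.comp_id]⟩
    rw [← hmap_comp_patt] at h
    rw [hmap_comp_perm_inj h]
    exact hg
end

section
/- Let ℓ ≤ n be positive integers and let G be a subgroup of S_ℓ. Then gComp^n(G) = Aut((G♮)̂); that is, the group of n-permutations all of whose ℓ-patterns lie in G equals the automorphism group of the ℓ-ary relation (G♮)̂ on [n]. -/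
open Equiv Finset Function

theorem range_hmap {ℓ n : ℕ} (I : Finset (Fin n)) (hI : I.card = ℓ) :
    Set.range (hmap I hI) = I :=
  Finset.range_orderEmbOfFin I hI

theorem comp_hmap {ℓ n : ℕ} (π : Equiv.Perm (Fin n)) (I : Finset (Fin n)) (hI : I.card = ℓ)
    (hJ : (I.image ⇑π).card = ℓ) :
    ⇑π ∘ hmap I hI = hmap (I.image ⇑π) hJ ∘ ⇑(patt π I hI) := by
  funext i
  simp [hmap, patt]

/-- Proposition 5.6 (last part): `gComp^n(G) = Aut ((G♮)̂)` for any subgroup `G ≤ S_ℓ`,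
where `G♮ = {(g 1, …, g ℓ) : g ∈ G}` is `G` viewed as an `ℓ`-ary relation on `[ℓ]`. -/
theorem stmt18 (ℓ n : ℕ) (hℓ : 0 < ℓ) (hn : ℓ ≤ n) (G : Subgroup (Equiv.Perm (Fin ℓ))) :
    CompSet n (G : Set (Equiv.Perm (Fin ℓ))) =
      {π : Equiv.Perm (Fin n) |
        Preserves ⇑π (hatRel n {s : Fin ℓ → Fin ℓ | ∃ g ∈ G, s = ⇑g})} := by
  ext π
  constructor
  · rintro hπ _ ⟨_, ⟨g, hg, rfl⟩, J, hJ, rfl⟩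
    have hK : (J.image ⇑π).card = ℓ := by
      rw [Finset.card_image_of_injective _ π.injective, hJ]
    refine ⟨⇑(patt π J hJ * g), ⟨_, G.mul_mem (hπ ⟨J, hJ, rfl⟩) hg, rfl⟩, J.image ⇑π, hK, ?_⟩
    rw [← Function.comp_assoc, comp_hmap π J hJ hK, Equiv.Perm.coe_mul, Function.comp_assoc]
  · rintro hπ _ ⟨I, hI, rfl⟩
    obtain ⟨_, ⟨g, hg, rfl⟩, J, hJ, h⟩ :=
      hπ (hmap I hI) ⟨_, ⟨1, G.one_mem, rfl⟩, I, hI, rfl⟩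
    have hIJ : I.image ⇑π = J := by
      apply Finset.coe_injective
      rw [Finset.coe_image, ← range_hmap I hI, ← Set.range_comp, h,
        g.surjective.range_comp, range_hmap]
    subst hIJ
    rw [comp_hmap π I hI hJ] at h
    rwa [Equiv.coe_fn_injective ((hmap_injective _ hJ).comp_left h)]
end
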